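/- Assume Γ is Q-polynomial with respect to E. Then for all vertices x, y ∈ X at distance ∂(x,y) = 1: E x̂ ⋆ E ŷ = [ (θ*_2 − θ*_1) E x⁺_y + (θ₁ − θ₂) θ*_1 E x̂ + (θ₂ − θ₀ + θ*_0 − θ*_1) E ŷ ] / ( |X| (θ₁ − θ₂) ). -/

import Mathlib

open Matrix Finset
open scoped Classical

/-- A distance-regular graph `Γ` with vertex set `X`, path-length distance
`G.dist`, diameter `d ≥ 2`, and intersection numbers `p h i j`. -/
structure DRG where
  X : Type
  [fin : Fintype X]
  [deceq : DecidableEq X]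
  G : SimpleGraph X
  conn : G.Connected
  d : ℕ
  d_ge_two : 2 ≤ d
  dist_le : ∀ x y : X, G.dist x y ≤ d
  dist_attained : ∃ x y : X, G.dist x y = d
  p : ℕ → ℕ → ℕ → ℕ
  dist_regular : ∀ (h i j : ℕ) (x y : X), G.dist x y = h →
    (Finset.univ.filter fun z => G.dist x z = i ∧ G.dist y z = j).card = p h i j

attribute [instance] DRG.fin DRG.deceq

namespace DRG

variable (Γ : DRG)

/-- `Γ_i(x) = {z : ∂(x,z) = i}`. -/
noncomputable def sphere (x : Γ.X) (i : ℕ) : Finset Γ.X :=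
  Finset.univ.filter fun z => Γ.G.dist x z = i

/-- The number of vertices `|X|`, as a real number. -/
noncomputable def n : ℝ := (Fintype.card Γ.X : ℝ)

/-- The `i`-th distance matrix `A_i`. -/
noncomputable def Ai (i : ℕ) : Matrix Γ.X Γ.X ℝ :=
  Matrix.of fun x y => if Γ.G.dist x y = i then (1 : ℝ) else 0

/-- The adjacency matrix `A = A_1`. -/
noncomputable def A : Matrix Γ.X Γ.X ℝ := Γ.Ai 1

/-- The all-ones matrix `J`. -/
def Jmat : Matrix Γ.X Γ.X ℝ := Matrix.of fun _ _ => (1 : ℝ)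

/-- `c_i = p^i_{1,i-1}` (so `c_0 = 0`). -/
noncomputable def c (i : ℕ) : ℝ := (Γ.p i 1 (i - 1) : ℝ)

/-- `a_i = p^i_{1,i}`. -/
noncomputable def a (i : ℕ) : ℝ := (Γ.p i 1 i : ℝ)

/-- `b_i = p^i_{1,i+1}` (so `b_d = 0`). -/
noncomputable def b (i : ℕ) : ℝ := (Γ.p i 1 (i + 1) : ℝ)

/-- The standard basis vector `x̂`. -/
noncomputable def hatv (x : Γ.X) : Γ.X → ℝ := Pi.single x 1

/-- `x⁺_y = Σ_{z ∈ Γ(x) ∩ Γ_{i+1}(y)} ẑ` where `i = ∂(x,y)`. -/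
noncomputable def plusv (x y : Γ.X) : Γ.X → ℝ :=
  ∑ z ∈ Γ.sphere x 1 ∩ Γ.sphere y (Γ.G.dist x y + 1), Γ.hatv z

/-- `x⁰_y = Σ_{z ∈ Γ(x) ∩ Γ_i(y)} ẑ` where `i = ∂(x,y)`. -/
noncomputable def zerov (x y : Γ.X) : Γ.X → ℝ :=
  ∑ z ∈ Γ.sphere x 1 ∩ Γ.sphere y (Γ.G.dist x y), Γ.hatv z

/-- `x⁻_y = Σ_{z ∈ Γ(x) ∩ Γ_{i-1}(y)} ẑ` where `i = ∂(x,y)`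
(for `i = 0` this is the zero vector, matching `Γ_{-1}(y) = ∅`). -/
noncomputable def minusv (x y : Γ.X) : Γ.X → ℝ :=
  ∑ z ∈ Γ.sphere x 1 ∩ Γ.sphere y (Γ.G.dist x y - 1), Γ.hatv z

/-- The Norton product `u ⋆ v = E (u ∘ v)`, where `∘` is the entrywise
(Hadamard) product of vectors. -/
noncomputable def norton (E : Matrix Γ.X Γ.X ℝ) (u v : Γ.X → ℝ) : Γ.X → ℝ :=
  E *ᵥ (u * v)

/-- `E 0, …, E d` is the sequence of primitive idempotents of the Bose–Mesner
algebra, with `E 0 = |X|⁻¹ J`, and `θ 0, …, θ d` are the corresponding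
(mutually distinct) eigenvalues, so that `A = Σ_i θ i • E i`. -/
def IsPrimIdemSeq (E : ℕ → Matrix Γ.X Γ.X ℝ) (θ : ℕ → ℝ) : Prop :=
  E 0 = (Γ.n)⁻¹ • Γ.Jmat ∧
  ∑ i ∈ Finset.range (Γ.d + 1), E i = 1 ∧
  (∀ i j : ℕ, i ≤ Γ.d → j ≤ Γ.d → E i * E j = if i = j then E i else 0) ∧
  Γ.A = ∑ i ∈ Finset.range (Γ.d + 1), θ i • E i ∧
  (∀ i j : ℕ, i ≤ Γ.d → j ≤ Γ.d → θ i = θ j → i = j)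

/-- `q h i j` are the Krein parameters:
`E i ∘ E j = |X|⁻¹ Σ_h q h i j • E h`, with `∘` the entrywise product. -/
def IsKrein (E : ℕ → Matrix Γ.X Γ.X ℝ) (q : ℕ → ℕ → ℕ → ℝ) : Prop :=
  ∀ i j : ℕ, i ≤ Γ.d → j ≤ Γ.d →
    Matrix.hadamard (E i) (E j) =
      (Γ.n)⁻¹ • ∑ h ∈ Finset.range (Γ.d + 1), q h i j • E h

/-- The ordering `E 1, …, E d` is `Q`-polynomial: for `0 ≤ h,i,j ≤ d`,
`q h i j = 0` if one of `h,i,j` is greater than the sum of the other two, and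
`q h i j ≠ 0` if one of `h,i,j` equals the sum of the other two. -/
def IsQPolynomial (q : ℕ → ℕ → ℕ → ℝ) : Prop :=
  ∀ h i j : ℕ, h ≤ Γ.d → i ≤ Γ.d → j ≤ Γ.d →
    ((i + j < h ∨ h + j < i ∨ h + i < j) → q h i j = 0) ∧
    ((h = i + j ∨ i = h + j ∨ j = h + i) → q h i j ≠ 0)

/-- `ts 0, …, ts d` are the (mutually distinct) dual eigenvalues associated
with `E`, i.e. `E = |X|⁻¹ Σ_i ts i • A i`.  The values `ts (-1)` and
`ts (d+1)` are arbitrary reals (indeterminates). -/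
def IsDualEigs (E : Matrix Γ.X Γ.X ℝ) (ts : ℤ → ℝ) : Prop :=
  E = (Γ.n)⁻¹ • ∑ i ∈ Finset.range (Γ.d + 1), ts i • Γ.Ai i

/-- The dual eigenvalues `ts 0, …, ts d` are mutually distinct. -/
def DualDistinct (ts : ℤ → ℝ) : Prop :=
  ∀ i j : ℕ, i ≤ Γ.d → j ≤ Γ.d → ts i = ts j → i = j

/-- `C(x,y) = E x⁻_y − c_i ((θ*_1 − θ*_{i-1})/(θ*_0 − θ*_i)) E x̂`,
where `i = ∂(x,y)`. -/
noncomputable def Cvec (E : Matrix Γ.X Γ.X ℝ) (ts : ℤ → ℝ) (x y : Γ.X) :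
    Γ.X → ℝ :=
  E *ᵥ Γ.minusv x y -
    (Γ.c (Γ.G.dist x y) *
      ((ts 1 - ts ((Γ.G.dist x y : ℤ) - 1)) / (ts 0 - ts (Γ.G.dist x y)))) •
      (E *ᵥ Γ.hatv x)

/-- `B(x,y) = E x⁺_y − b_i ((θ*_1 − θ*_{i+1})/(θ*_0 − θ*_i)) E x̂`,
where `i = ∂(x,y)`. -/
noncomputable def Bvec (E : Matrix Γ.X Γ.X ℝ) (ts : ℤ → ℝ) (x y : Γ.X) :
    Γ.X → ℝ :=
  E *ᵥ Γ.plusv x y -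
    (Γ.b (Γ.G.dist x y) *
      ((ts 1 - ts ((Γ.G.dist x y : ℤ) + 1)) / (ts 0 - ts (Γ.G.dist x y)))) •
      (E *ᵥ Γ.hatv x)

end DRG

namespace DRG

variable {Γ : DRG}

/-- The sum of all squared triple products of the rows of two symmetric idempotents. -/
lemma sum_sq_triple {ι : Type*} [Fintype ι] (P Q : Matrix ι ι ℝ)
    (hP : Pᵀ * P = P) (hQ : Qᵀ * Q = Q) :
    ∑ t : ι × ι × ι, (∑ z, P t.1 z * P t.2.1 z * Q t.2.2 z) ^ 2 =
      ∑ z, ∑ z', P z z' * P z z' * Q z z' := by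
  have h1 : ∀ t : ι × ι × ι, (∑ z, P t.1 z * P t.2.1 z * Q t.2.2 z) ^ 2 =
      ∑ z, ∑ z', (P t.1 z * P t.2.1 z * Q t.2.2 z) * (P t.1 z' * P t.2.1 z' * Q t.2.2 z') := by
    intro t
    rw [sq, Finset.sum_mul_sum]
  simp_rw [h1]
  rw [Finset.sum_comm]
  refine Finset.sum_congr rfl fun z _ => ?_
  rw [Finset.sum_comm]
  refine Finset.sum_congr rfl fun z' _ => ?_
  have hp : P z z' = ∑ a, P a z * P a z' := by
    conv_lhs => rw [← hP]
    simp [Matrix.mul_apply]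
  have hq : Q z z' = ∑ a, Q a z * Q a z' := by
    conv_lhs => rw [← hQ]
    simp [Matrix.mul_apply]
  rw [hp, hq, mul_assoc, Finset.sum_mul_sum, Finset.sum_mul_sum, Fintype.sum_prod_type]
  refine Finset.sum_congr rfl fun a _ => ?_
  rw [Fintype.sum_prod_type]
  refine Finset.sum_congr rfl fun b _ => ?_
  rw [Finset.mul_sum]
  refine Finset.sum_congr rfl fun c _ => ?_
  ring

lemma Ai_transpose (i : ℕ) : (Γ.Ai i)ᵀ = Γ.Ai i := by
  ext x y
  simp [Ai, SimpleGraph.dist_comm]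

lemma n_ne_zero : Γ.n ≠ 0 := by
  have := Γ.conn.nonempty
  simp [n]

section Idempotents

variable {E : ℕ → Matrix Γ.X Γ.X ℝ} {θ : ℕ → ℝ}

lemma IsPrimIdemSeq.mul_A (hE : Γ.IsPrimIdemSeq E θ) {h : ℕ} (hh : h ≤ Γ.d) :
    E h * Γ.A = θ h • E h := by
  obtain ⟨-, -, hmul, hA, -⟩ := hE
  rw [hA, Finset.mul_sum, Finset.sum_eq_single h]
  · simp [hmul h h hh hh]
  · intro k hk hne
    rw [Matrix.mul_smul, hmul h k hh (by grind), if_neg hne.symm, smul_zero]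
  · grind

lemma IsPrimIdemSeq.A_mul (hE : Γ.IsPrimIdemSeq E θ) {h : ℕ} (hh : h ≤ Γ.d) :
    Γ.A * E h = θ h • E h := by
  obtain ⟨-, -, hmul, hA, -⟩ := hE
  rw [hA, Finset.sum_mul, Finset.sum_eq_single h]
  · simp [hmul h h hh hh]
  · intro k hk hne
    rw [Matrix.smul_mul, hmul k h (by grind) hh, if_neg hne, smul_zero]
  · grind

lemma IsPrimIdemSeq.transpose_eq (hE : Γ.IsPrimIdemSeq E θ) {h : ℕ} (hh : h ≤ Γ.d) :
    (E h)ᵀ = E h := by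
  have hAt : Γ.A * (E h)ᵀ = θ h • (E h)ᵀ := by
    have := congrArg Matrix.transpose (hE.mul_A hh)
    rwa [Matrix.transpose_mul, Matrix.transpose_smul, A, Ai_transpose] at this
  have hz : ∀ k, k ≤ Γ.d → k ≠ h → E k * (E h)ᵀ = 0 := by
    intro k hk hne
    have h1 : θ k • (E k * (E h)ᵀ) = θ h • (E k * (E h)ᵀ) := by
      rw [← Matrix.smul_mul, ← hE.mul_A hk, Matrix.mul_assoc, hAt, Matrix.mul_smul]
    have h2 : (θ k - θ h) • (E k * (E h)ᵀ) = 0 := by rw [sub_smul, h1, sub_self]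
    exact (smul_eq_zero.mp h2).resolve_left
      (sub_ne_zero.mpr fun he => hne (hE.2.2.2.2 k h hk hh he))
  have h3 : (E h)ᵀ = E h * (E h)ᵀ := by
    conv_lhs => rw [← Matrix.one_mul (E h)ᵀ, ← hE.2.1, Finset.sum_mul]
    rw [Finset.sum_eq_single h]
    · intro k hk hne
      exact hz k (by grind) hne
    · grind
  have h4 := congrArg Matrix.transpose h3
  rw [Matrix.transpose_mul, Matrix.transpose_transpose] at h4
  rw [h3, ← h4]

lemma IsPrimIdemSeq.sum_hadamard (hE : Γ.IsPrimIdemSeq E θ) {k h : ℕ}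
    (hk : k ≤ Γ.d) (hh : h ≤ Γ.d) (hne : k ≠ h) :
    ∑ z, ∑ z', E k z z' * E h z z' = 0 := by
  have h1 := hE.2.2.1 k h hk hh
  rw [if_neg hne] at h1
  refine Finset.sum_eq_zero fun z _ => ?_
  have h2 := congrFun (congrFun h1 z) z
  rw [Matrix.mul_apply] at h2
  refine Eq.trans (Finset.sum_congr rfl fun z' _ => ?_) h2
  conv_lhs => rw [← hE.transpose_eq hh, Matrix.transpose_apply]

/-- If the Krein parameter `q h 1 1` vanishes, then so do all triple products of rows of
`E 1`, `E 1`, `E h`. -/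
lemma IsPrimIdemSeq.triple_eq_zero (hE : Γ.IsPrimIdemSeq E θ) {q : ℕ → ℕ → ℕ → ℝ}
    (hq : Γ.IsKrein E q) {i h : ℕ} (hi : i ≤ Γ.d) (hh : h ≤ Γ.d) (hqh : q h i i = 0)
    (a b c : Γ.X) : ∑ z, E i a z * E i b z * E h c z = 0 := by
  have hs := sum_sq_triple (E i) (E h)
    (by rw [hE.transpose_eq hi, hE.2.2.1 i i hi hi, if_pos rfl])
    (by rw [hE.transpose_eq hh, hE.2.2.1 h h hh hh, if_pos rfl])
  have hr : ∑ z, ∑ z', E i z z' * E i z z' * E h z z' = 0 := by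
    have h1 : ∀ z z', E i z z' * E i z z' * E h z z' =
        ∑ k ∈ Finset.range (Γ.d + 1), Γ.n⁻¹ * q k i i * (E k z z' * E h z z') := by
      intro z z'
      have := congrFun (congrFun (hq i i hi hi) z) z'
      rw [Matrix.hadamard_apply, Matrix.smul_apply, Matrix.sum_apply] at this
      rw [this, smul_eq_mul, Finset.mul_sum, Finset.sum_mul]
      refine Finset.sum_congr rfl fun k _ => ?_
      rw [Matrix.smul_apply, smul_eq_mul]
      ring
    simp_rw [h1]
    rw [Finset.sum_congr rfl fun z _ => Finset.sum_comm, Finset.sum_comm]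
    refine Finset.sum_eq_zero fun k hk => ?_
    simp_rw [← Finset.mul_sum]
    rcases eq_or_ne k h with rfl | hne
    · rw [hqh, mul_zero, zero_mul]
    · rw [hE.sum_hadamard (by grind) hh hne, mul_zero]
  rw [hr, Finset.sum_eq_zero_iff_of_nonneg fun t _ => sq_nonneg _] at hs
  simpa using hs (a, b, c) (Finset.mem_univ _)

lemma mulVec_hatv (M : Matrix Γ.X Γ.X ℝ) (x z : Γ.X) : (M *ᵥ Γ.hatv x) z = M z x := by
  simp [hatv]

lemma IsPrimIdemSeq.norton_mulVec_eq_zero (hE : Γ.IsPrimIdemSeq E θ) {q : ℕ → ℕ → ℕ → ℝ}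
    (hq : Γ.IsKrein E q) {i h : ℕ} (hi : i ≤ Γ.d) (hh : h ≤ Γ.d) (hqh : q h i i = 0)
    (x y : Γ.X) : Γ.norton (E i) (E i *ᵥ Γ.hatv y) (E h *ᵥ Γ.hatv x) = 0 := by
  ext a
  rw [norton, Matrix.mulVec, dotProduct, Pi.zero_apply,
    ← hE.triple_eq_zero hq hi hh hqh a y x]
  refine Finset.sum_congr rfl fun z _ => ?_
  rw [Pi.mul_apply, mulVec_hatv, mulVec_hatv, ← Matrix.transpose_apply (E i) y z,
    ← Matrix.transpose_apply (E h) x z, hE.transpose_eq hi, hE.transpose_eq hh, mul_assoc]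

end Idempotents

lemma norton_smul (M : Matrix Γ.X Γ.X ℝ) (r : ℝ) (u v : Γ.X → ℝ) :
    Γ.norton M u (r • v) = r • Γ.norton M u v := by
  rw [norton, mul_smul_comm, Matrix.mulVec_smul, norton]

lemma norton_sum (M : Matrix Γ.X Γ.X ℝ) (u : Γ.X → ℝ) (s : Finset ℕ) (f : ℕ → Γ.X → ℝ) :
    Γ.norton M u (∑ i ∈ s, f i) = ∑ i ∈ s, Γ.norton M u (f i) := by
  rw [norton, Finset.mul_sum, Matrix.mulVec_sum]
  rfl

lemma norton_comm (M : Matrix Γ.X Γ.X ℝ) (u v : Γ.X → ℝ) :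
    Γ.norton M u v = Γ.norton M v u := by
  rw [norton, mul_comm, norton]

lemma IsDualEigs.apply {M : Matrix Γ.X Γ.X ℝ} {ts : ℤ → ℝ} (hts : Γ.IsDualEigs M ts)
    (x y : Γ.X) : M x y = Γ.n⁻¹ * ts (Γ.G.dist x y) := by
  rw [hts, Matrix.smul_apply, Matrix.sum_apply, smul_eq_mul,
    Finset.sum_eq_single (Γ.G.dist x y)]
  · simp [Ai]
  · intro k _ hne
    simp [Ai, hne.symm]
  · have := Γ.dist_le x y
    grind

lemma plusv_apply (x y z : Γ.X) : Γ.plusv x y z =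
    if Γ.G.dist x z = 1 ∧ Γ.G.dist y z = Γ.G.dist x y + 1 then 1 else 0 := by
  simp [plusv, hatv, Finset.sum_apply, Pi.single_apply, sphere]

lemma dual_mul_A_hatv {M : Matrix Γ.X Γ.X ℝ} {ts : ℤ → ℝ} (hts : Γ.IsDualEigs M ts)
    {x y : Γ.X} (hxy : Γ.G.dist x y = 1) :
    (M *ᵥ Γ.hatv y) * (Γ.A *ᵥ Γ.hatv x) =
      Γ.n⁻¹ • ((ts 0 - ts 1) • Γ.hatv y + ts 1 • (Γ.A *ᵥ Γ.hatv x) +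
        (ts 2 - ts 1) • Γ.plusv x y) := by
  ext z
  have hA : (Γ.A *ᵥ Γ.hatv x) z = if Γ.G.dist x z = 1 then 1 else 0 := by
    rw [mulVec_hatv, A, Ai, Matrix.of_apply, SimpleGraph.dist_comm]
  have hy : Γ.hatv y z = if Γ.G.dist y z = 0 then 1 else 0 := by
    simp [hatv, Pi.single_apply, Γ.conn.dist_eq_zero_iff, eq_comm]
  simp only [Pi.mul_apply, Pi.add_apply, Pi.smul_apply, smul_eq_mul]
  rw [mulVec_hatv, hts.apply, hA, hy, plusv_apply, hxy, SimpleGraph.dist_comm (u := z)]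
  by_cases hz : Γ.G.dist x z = 1
  · have htri : Γ.G.dist y z ≤ 2 := by
      have := Γ.conn.dist_triangle (u := y) (v := x) (w := z)
      rw [SimpleGraph.dist_comm (u := y) (v := x)] at this
      omega
    generalize Γ.G.dist y z = m at *
    interval_cases m <;> simp [hz]
  · have hyz : Γ.G.dist y z ≠ 0 := by
      intro h0
      rw [Γ.conn.dist_eq_zero_iff] at h0
      exact hz (h0 ▸ hxy)
    simp [hz, hyz]

lemma dual_mul_hatv {M : Matrix Γ.X Γ.X ℝ} {ts : ℤ → ℝ} (hts : Γ.IsDualEigs M ts)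
    (x y : Γ.X) :
    (M *ᵥ Γ.hatv y) * Γ.hatv x = (Γ.n⁻¹ * ts (Γ.G.dist x y)) • Γ.hatv x := by
  ext z
  rw [Pi.mul_apply, mulVec_hatv, hts.apply, Pi.smul_apply, smul_eq_mul]
  rcases eq_or_ne z x with rfl | h
  · rfl
  · simp [hatv, h]

end DRG

/-- Corollary 3.8(ii): the `i = 1` case. -/
theorem DRG.norton_product_dist_one (Γ : DRG) (E : ℕ → Matrix Γ.X Γ.X ℝ) (θ : ℕ → ℝ)
    (hE : Γ.IsPrimIdemSeq E θ)
    (q : ℕ → ℕ → ℕ → ℝ) (hq : Γ.IsKrein E q) (hQ : Γ.IsQPolynomial q)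
    (ts : ℤ → ℝ) (hts : Γ.IsDualEigs (E 1) ts) (hts' : Γ.DualDistinct ts) (x y : Γ.X)
    (hxy : Γ.G.dist x y = 1) :
    Γ.norton (E 1) (E 1 *ᵥ Γ.hatv x) (E 1 *ᵥ Γ.hatv y) =
      (Γ.n * (θ 1 - θ 2))⁻¹ •
        ((ts 2 - ts 1) • (E 1 *ᵥ Γ.plusv x y) +
          ((θ 1 - θ 2) * ts 1) • (E 1 *ᵥ Γ.hatv x) +
          (θ 2 - θ 0 + ts 0 - ts 1) • (E 1 *ᵥ Γ.hatv y)) := by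
  have hd := Γ.d_ge_two
  have hidem : E 1 * E 1 = E 1 := by
    rw [hE.2.2.1 1 1 (by omega) (by omega), if_pos rfl]
  have hθ : θ 1 - θ 2 ≠ 0 := sub_ne_zero.mpr fun h => by
    have := hE.2.2.2.2 1 2 (by omega) (by omega) h
    omega
  have hvan : ∀ h ∈ Finset.range (Γ.d + 1), h ∉ Finset.range 3 →
      Γ.norton (E 1) (E 1 *ᵥ Γ.hatv y) (E h *ᵥ Γ.hatv x) = 0 := by
    intro h hh h3
    have hh' : h ≤ Γ.d := by grind
    refine hE.norton_mulVec_eq_zero hq (by omega) hh' ?_ x y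
    exact (hQ h 1 1 hh' (by omega) (by omega)).1 (by grind)
  have hsub : Finset.range 3 ⊆ Finset.range (Γ.d + 1) := Finset.range_mono (by omega)
  -- Only the components `E 0`, `E 1`, `E 2` contribute to the product.
  have hone : Γ.norton (E 1) (E 1 *ᵥ Γ.hatv y) (Γ.hatv x) =
      ∑ h ∈ Finset.range 3, Γ.norton (E 1) (E 1 *ᵥ Γ.hatv y) (E h *ᵥ Γ.hatv x) := by
    rw [Finset.sum_subset hsub hvan, ← norton_sum, ← Matrix.sum_mulVec, hE.2.1,
      Matrix.one_mulVec]
  have hadj : Γ.norton (E 1) (E 1 *ᵥ Γ.hatv y) (Γ.A *ᵥ Γ.hatv x) =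
      ∑ h ∈ Finset.range 3, θ h • Γ.norton (E 1) (E 1 *ᵥ Γ.hatv y) (E h *ᵥ Γ.hatv x) := by
    rw [Finset.sum_subset hsub fun h hh h3 => by rw [hvan h hh h3, smul_zero], hE.2.2.2.1,
      Matrix.sum_mulVec, norton_sum]
    refine Finset.sum_congr rfl fun h _ => ?_
    rw [Matrix.smul_mulVec, norton_smul]
  have hzero : Γ.norton (E 1) (E 1 *ᵥ Γ.hatv y) (E 0 *ᵥ Γ.hatv x) =
      Γ.n⁻¹ • (E 1 *ᵥ Γ.hatv y) := by
    have h0 : (E 1 *ᵥ Γ.hatv y) * (E 0 *ᵥ Γ.hatv x) = Γ.n⁻¹ • (E 1 *ᵥ Γ.hatv y) := by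
      ext z
      rw [Pi.mul_apply, mulVec_hatv (E 0), hE.1]
      simp [Jmat, mul_comm]
    rw [norton, h0, Matrix.mulVec_smul, Matrix.mulVec_mulVec, hidem]
  have hone' : Γ.norton (E 1) (E 1 *ᵥ Γ.hatv y) (Γ.hatv x) =
      (Γ.n⁻¹ * ts 1) • (E 1 *ᵥ Γ.hatv x) := by
    rw [norton, dual_mul_hatv hts, hxy, Matrix.mulVec_smul, Nat.cast_one]
  have hadj' : Γ.norton (E 1) (E 1 *ᵥ Γ.hatv y) (Γ.A *ᵥ Γ.hatv x) =
      Γ.n⁻¹ • ((ts 0 - ts 1) • (E 1 *ᵥ Γ.hatv y) + ts 1 • θ 1 • (E 1 *ᵥ Γ.hatv x) +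
        (ts 2 - ts 1) • (E 1 *ᵥ Γ.plusv x y)) := by
    rw [norton, dual_mul_A_hatv hts hxy]
    simp only [Matrix.mulVec_smul, Matrix.mulVec_add]
    rw [Matrix.mulVec_mulVec, hE.mul_A (by omega), Matrix.smul_mulVec]
  rw [hone'] at hone
  rw [hadj'] at hadj
  rw [norton_comm]
  simp only [Finset.sum_range_succ, Finset.sum_range_zero, zero_add, hzero] at hone hadj
  ext z
  have e1 := congrFun hone z
  have e2 := congrFun hadj z
  simp only [Pi.add_apply, Pi.smul_apply, smul_eq_mul] at e1 e2 ⊢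
  have hn := Γ.n_ne_zero
  rw [mul_inv]
  field_simp at e1 e2 ⊢
  linear_combination θ 2 * e1 - e2
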